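/- Interpolation inequality for the mixing coefficients: if θ ∈ [0,1], 1 ≤ p₀,p₁,q₀,q₁ ≤ ∞ and 1/p = (1−θ)/p₀ + θ/p₁, 1/q = (1−θ)/q₀ + θ/q₁, then ϖ_{q,p}(𝓖,𝓗) ≤ 2(ϖ_{q₀,p₀}(𝓖,𝓗))^{1−θ}(ϖ_{q₁,p₁}(𝓖,𝓗))^{θ}. -/

import Mathlib

open MeasureTheory Filter Set ProbabilityTheory
open scoped ENNReal NNReal Topology

noncomputable section

/-- The mixing coefficient `ϖ_{q,p}(𝓖,𝓗)`. -/
def varpi {Ω : Type*} {mΩ : MeasurableSpace Ω} (P : Measure Ω)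
    (G H : MeasurableSpace Ω) (q p : ℝ≥0∞) : ℝ≥0∞ :=
  ⨆ g : {g : Ω → ℝ // Measurable[H] g ∧ eLpNorm g q P ≤ 1},
    eLpNorm (fun ω => (P[g.1|G]) ω - ∫ x, g.1 x ∂P) p P

/-- `α(𝓖,𝓗) = ϖ_{∞,1}(𝓖,𝓗)/4`. -/
def alphaMix {Ω : Type*} {mΩ : MeasurableSpace Ω} (P : Measure Ω)
    (G H : MeasurableSpace Ω) : ℝ≥0∞ := varpi P G H ⊤ 1 / 4

/-- `ρ(𝓖,𝓗) = ϖ_{2,2}(𝓖,𝓗)`. -/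
def rhoMix {Ω : Type*} {mΩ : MeasurableSpace Ω} (P : Measure Ω)
    (G H : MeasurableSpace Ω) : ℝ≥0∞ := varpi P G H 2 2

/-- `φ(𝓖,𝓗) = ϖ_{∞,∞}(𝓖,𝓗)/2`. -/
def phiMix {Ω : Type*} {mΩ : MeasurableSpace Ω} (P : Measure Ω)
    (G H : MeasurableSpace Ω) : ℝ≥0∞ := varpi P G H ⊤ ⊤ / 2

/-- `ψ(𝓖,𝓗) = ϖ_{1,∞}(𝓖,𝓗)`. -/
def psiMix {Ω : Type*} {mΩ : MeasurableSpace Ω} (P : Measure Ω)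
    (G H : MeasurableSpace Ω) : ℝ≥0∞ := varpi P G H 1 ⊤

lemma exists_simpleFunc_abs_le_tendsto {Ω : Type*} {m : MeasurableSpace Ω} {f : Ω → ℝ}
    (hf : Measurable f) :
    ∃ s : ℕ → SimpleFunc Ω ℝ, (∀ n ω, |s n ω| ≤ |f ω|) ∧
      ∀ ω, Tendsto (fun n => s n ω) atTop (𝓝 (f ω)) := by
  let a : ℕ → SimpleFunc Ω ℝ := fun n =>
    (SimpleFunc.eapprox (fun ω => ENNReal.ofReal (f ω)) n).map ENNReal.toReal
  let b : ℕ → SimpleFunc Ω ℝ := fun n =>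
    (SimpleFunc.eapprox (fun ω => ENNReal.ofReal (-f ω)) n).map ENNReal.toReal
  have approx_le : ∀ {h : Ω → ℝ} (_ : Measurable h) (n : ℕ) (ω : Ω),
      (SimpleFunc.eapprox (fun ω => ENNReal.ofReal (h ω)) n ω).toReal ≤ max (h ω) 0 := by
    intro h hh n ω
    rw [← ENNReal.toReal_ofReal']
    refine ENNReal.toReal_mono ENNReal.ofReal_ne_top ?_
    rw [← SimpleFunc.iSup_eapprox_apply (f := fun ω => ENNReal.ofReal (h ω))
      hh.ennreal_ofReal ω]
    exact le_iSup (fun n => SimpleFunc.eapprox (fun ω => ENNReal.ofReal (h ω)) n ω) n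
  have approx_tendsto : ∀ {h : Ω → ℝ} (_ : Measurable h) (ω : Ω),
      Tendsto (fun n => (SimpleFunc.eapprox (fun ω => ENNReal.ofReal (h ω)) n ω).toReal)
        atTop (𝓝 (max (h ω) 0)) := by
    intro h hh ω
    rw [← ENNReal.toReal_ofReal']
    exact (ENNReal.tendsto_toReal ENNReal.ofReal_ne_top).comp
      (SimpleFunc.tendsto_eapprox (f := fun ω => ENNReal.ofReal (h ω)) hh.ennreal_ofReal ω)
  refine ⟨fun n => a n - b n, fun n ω => ?_, fun ω => ?_⟩
  · have ha := approx_le hf n ω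
    have hb := approx_le hf.neg n ω
    have ha0 : 0 ≤ a n ω := ENNReal.toReal_nonneg
    have hb0 : 0 ≤ b n ω := ENNReal.toReal_nonneg
    change a n ω ≤ _ at ha
    change b n ω ≤ max (-f ω) 0 at hb
    change |a n ω - b n ω| ≤ |f ω|
    rcases le_total 0 (f ω) with h | h
    · rw [max_eq_left h] at ha
      rw [max_eq_right (by linarith)] at hb
      rw [abs_of_nonneg h, abs_le]
      constructor <;> linarith
    · rw [max_eq_right h] at ha
      rw [max_eq_left (by linarith)] at hb
      rw [abs_of_nonpos h, abs_le]
      constructor <;> linarith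
  · have h := (approx_tendsto hf ω).sub (approx_tendsto hf.neg ω)
    have : max (f ω) 0 - max ((-f) ω) 0 = f ω := by
      rw [Pi.neg_apply]
      rcases le_total 0 (f ω) with h | h
      · rw [max_eq_left h, max_eq_right (by linarith)]; ring
      · rw [max_eq_right h, max_eq_left (by linarith)]; ring
    rw [this] at h
    exact h

lemma eLpNorm_condExp_sub_integral_le {Ω : Type*} {G H mΩ : MeasurableSpace Ω} (P : Measure Ω)
    [IsProbabilityMeasure P] (hH : H ≤ mΩ) {p q : ℝ≥0∞} (hq : 1 ≤ q)
    {u : Ω → ℝ} (hu : Measurable[H] u) (huq : eLpNorm u q P ≠ ∞) :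
    eLpNorm (fun ω => (P[u|G]) ω - ∫ x, u x ∂P) p P ≤ varpi P G H q p * eLpNorm u q P := by
  by_cases h0 : eLpNorm u q P = 0
  · have hu0 : u =ᵐ[P] 0 :=
      (eLpNorm_eq_zero_iff (hu.mono hH le_rfl).aestronglyMeasurable (by positivity)).1 h0
    have h1 : (fun ω => (P[u|G]) ω - ∫ x, u x ∂P) =ᵐ[P] 0 := by
      filter_upwards [condExp_congr_ae (m := G) hu0] with ω hω
      rw [hω, integral_congr_ae hu0]
      simp
    rw [eLpNorm_congr_ae h1]
    simp
  set N := (eLpNorm u q P).toReal with hN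
  have hNpos : 0 < N := ENNReal.toReal_pos h0 huq
  have hNe : eLpNorm u q P = ENNReal.ofReal N := (ENNReal.ofReal_toReal huq).symm
  have hv : eLpNorm (N⁻¹ • u) q P ≤ 1 := by
    rw [eLpNorm_const_smul, hNe, Real.enorm_of_nonneg (by positivity),
      ← ENNReal.ofReal_mul (by positivity), inv_mul_cancel₀ hNpos.ne']
    simp
  have hle : eLpNorm (fun ω => (P[N⁻¹ • u|G]) ω - ∫ x, (N⁻¹ • u) x ∂P) p P ≤ varpi P G H q p :=
    le_iSup (fun g : {g : Ω → ℝ // Measurable[H] g ∧ eLpNorm g q P ≤ 1} =>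
      eLpNorm (fun ω => (P[g.1|G]) ω - ∫ x, g.1 x ∂P) p P) ⟨N⁻¹ • u, hu.const_smul _, hv⟩
  have heq : (fun ω => (P[u|G]) ω - ∫ x, u x ∂P) =ᵐ[P]
      N • fun ω => (P[N⁻¹ • u|G]) ω - ∫ x, (N⁻¹ • u) x ∂P := by
    filter_upwards [condExp_smul (μ := P) N⁻¹ u G] with ω hω
    simp only [Pi.smul_apply, hω, smul_eq_mul, integral_const_mul]
    field_simp
  rw [eLpNorm_congr_ae heq, eLpNorm_const_smul, Real.enorm_of_nonneg hNpos.le, ← hNe, mul_comm]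
  gcongr

lemma integral_condExp_sub_integral_mul {Ω 𝕜 : Type*} [RCLike 𝕜] {G mΩ : MeasurableSpace Ω}
    (P : Measure Ω) [IsFiniteMeasure P] (hG : G ≤ mΩ) {f g : Ω → 𝕜} (hf : Integrable f P)
    (hg : StronglyMeasurable[G] g) {L : ℝ} (hL : ∀ ω, ‖g ω‖ ≤ L) :
    ∫ ω, ((P[f|G]) ω - ∫ x, f x ∂P) * g ω ∂P =
      ∫ ω, f ω * g ω ∂P - (∫ ω, f ω ∂P) * ∫ ω, g ω ∂P := by
  have hgm : AEStronglyMeasurable g P := (hg.mono hG).aestronglyMeasurable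
  have hgi : Integrable g P := .of_bound hgm L (ae_of_all _ hL)
  have hcg : Integrable (fun ω => (P[f|G]) ω * g ω) P :=
    integrable_condExp.mul_bdd hgm (ae_of_all _ hL)
  simp only [sub_mul]
  rw [integral_sub hcg (hgi.const_mul _), integral_const_mul,
    ← integral_condExp hG (f := fun ω => f ω * g ω)]
  congr 1
  refine integral_congr_ae ?_
  filter_upwards [condExp_stronglyMeasurable_bilin_of_bound (μ := P) (.mul ℝ 𝕜) hG hg hf L
    (ae_of_all _ hL)] with ω hω
  simp only [ContinuousLinearMap.mul_apply'] at hω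
  rw [mul_comm, ← hω]
  simp only [mul_comm]

lemma enorm_integral_mul_sub_le {Ω : Type*} {G H mΩ : MeasurableSpace Ω} (P : Measure Ω)
    [IsProbabilityMeasure P] (hG : G ≤ mΩ) (hH : H ≤ mΩ)
    {p p' q : ℝ≥0∞} [ENNReal.HolderConjugate p p'] (hq : 1 ≤ q)
    (f : @SimpleFunc Ω H ℂ) (g : @SimpleFunc Ω G ℂ) :
    ‖∫ ω, f ω * g ω ∂P - (∫ ω, f ω ∂P) * ∫ ω, g ω ∂P‖ₑ ≤
      2 * varpi P G H q p * eLpNorm f q P * eLpNorm g p' P := by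
  have hp : 1 ≤ p := ENNReal.HolderConjugate.one_le p p'
  obtain ⟨K, hK⟩ := @SimpleFunc.exists_forall_norm_le _ _ H _ f
  obtain ⟨L, hL⟩ := @SimpleFunc.exists_forall_norm_le _ _ G _ g
  have hfH : StronglyMeasurable[H] f := @SimpleFunc.stronglyMeasurable _ _ H _ f
  have hgG : StronglyMeasurable[G] g := @SimpleFunc.stronglyMeasurable _ _ G _ g
  have hfm : AEStronglyMeasurable f P := (hfH.mono hH).aestronglyMeasurable
  have hgm : AEStronglyMeasurable g P := (hgG.mono hG).aestronglyMeasurable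
  have hft : MemLp f ∞ P := memLp_top_of_bound hfm K (ae_of_all _ hK)
  have hgt : MemLp g ∞ P := memLp_top_of_bound hgm L (ae_of_all _ hL)
  have hfi : Integrable f P := hft.integrable le_top
  have hgi : Integrable g P := hgt.integrable le_top
  set W : Ω → ℂ := fun ω => (P[f|G]) ω - ∫ x, f x ∂P with hW
  have hint : ∫ ω, W ω * g ω ∂P = ∫ ω, f ω * g ω ∂P - (∫ ω, f ω ∂P) * ∫ ω, g ω ∂P :=
    integral_condExp_sub_integral_mul P hG hfi hgG hL
  have hWm : AEStronglyMeasurable W P := (integrable_condExp.sub (integrable_const _)).1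
  have part : ∀ T : ℂ →L[ℝ] ℝ, (∀ z, ‖T z‖ ≤ ‖z‖) →
      eLpNorm (fun ω => T (W ω)) p P ≤ varpi P G H q p * eLpNorm f q P := by
    intro T hT
    have hTf : eLpNorm (fun ω => T (f ω)) q P ≤ eLpNorm f q P :=
      eLpNorm_mono fun ω => hT _
    have h1 : (fun ω => T (W ω)) =ᵐ[P]
        fun ω => (P[fun ω => T (f ω)|G]) ω - ∫ x, T (f x) ∂P := by
      filter_upwards [T.comp_condExp_comm (m := G) hfi] with ω hω
      rw [T.integral_comp_comm hfi, hW, map_sub]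
      exact congrArg (· - _) hω
    rw [eLpNorm_congr_ae h1]
    refine (eLpNorm_condExp_sub_integral_le P hH hq (T.measurable.comp hfH.measurable)
      (hTf.trans_lt (hft.mono_exponent le_top).2).ne).trans ?_
    gcongr
    exact hTf
  have hWp : eLpNorm W p P ≤ 2 * varpi P G H q p * eLpNorm f q P := by
    have hdecomp : W = (fun ω => ((Complex.reCLM (W ω) : ℝ) : ℂ)) +
        fun ω => ((Complex.imCLM (W ω) : ℝ) : ℂ) * Complex.I := by
      ext ω
      simp [Complex.re_add_im]
    have hre : AEStronglyMeasurable (fun ω => ((Complex.reCLM (W ω) : ℝ) : ℂ)) P :=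
      (Complex.continuous_ofReal.comp Complex.reCLM.continuous).comp_aestronglyMeasurable hWm
    have him : AEStronglyMeasurable (fun ω => ((Complex.imCLM (W ω) : ℝ) : ℂ) * Complex.I) P :=
      ((Complex.continuous_ofReal.comp Complex.imCLM.continuous).mul
        continuous_const).comp_aestronglyMeasurable hWm
    have e1 : eLpNorm (fun ω => ((Complex.reCLM (W ω) : ℝ) : ℂ)) p P =
        eLpNorm (fun ω => Complex.reCLM (W ω)) p P :=
      eLpNorm_congr_norm_ae (ae_of_all _ fun ω => by simp)
    have e2 : eLpNorm (fun ω => ((Complex.imCLM (W ω) : ℝ) : ℂ) * Complex.I) p P =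
        eLpNorm (fun ω => Complex.imCLM (W ω)) p P :=
      eLpNorm_congr_norm_ae (ae_of_all _ fun ω => by simp)
    calc eLpNorm W p P ≤ eLpNorm (fun ω => ((Complex.reCLM (W ω) : ℝ) : ℂ)) p P +
          eLpNorm (fun ω => ((Complex.imCLM (W ω) : ℝ) : ℂ) * Complex.I) p P := by
          conv_lhs => rw [hdecomp]
          exact eLpNorm_add_le hre him hp
      _ ≤ varpi P G H q p * eLpNorm f q P + varpi P G H q p * eLpNorm f q P := by
          rw [e1, e2]
          exact add_le_add (part _ Complex.abs_re_le_norm) (part _ Complex.abs_im_le_norm)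
      _ = _ := by ring
  rw [← hint]
  calc ‖∫ ω, W ω * g ω ∂P‖ₑ ≤ ∫⁻ ω, ‖W ω * g ω‖ₑ ∂P := enorm_integral_le_lintegral_enorm _
    _ = eLpNorm (W • (g : Ω → ℂ)) 1 P := by
        rw [eLpNorm_one_eq_lintegral_enorm]; rfl
    _ ≤ eLpNorm W p P * eLpNorm g p' P := eLpNorm_smul_le_mul_eLpNorm hgm hWm
    _ ≤ _ := by gcongr

lemma eLpNorm_le_of_forall_nonneg {Ω : Type*} {m mΩ : MeasurableSpace Ω} (P : Measure Ω)
    [IsFiniteMeasure P] (hm : m ≤ mΩ) {p p' : ℝ≥0∞} [ENNReal.HolderConjugate p p']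
    {u : Ω → ℝ} (hu : Measurable[m] u) {C : ℝ≥0∞}
    (h : ∀ (g : Ω → ℝ) (K : ℝ), Measurable[m] g → (∀ ω, 0 ≤ g ω) → (∀ ω, g ω ≤ K) →
      eLpNorm g p' P ≤ 1 → ∫⁻ ω, ‖u ω‖ₑ * ENNReal.ofReal (g ω) ∂P ≤ C) :
    eLpNorm u p P ≤ C := by
  have hum : Measurable u := hu.mono hm le_rfl
  by_cases hptop : p = ∞
  · have hp' : p' = 1 := (ENNReal.HolderConjugate.eq_top_iff_eq_one p p').1 hptop
    subst hptop hp'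
    rw [eLpNorm_exponent_top]
    refine le_of_forall_lt_imp_le_of_dense fun c hc => ?_
    set A : Set Ω := {ω | c ≤ ‖u ω‖ₑ} with hA
    have hAm : MeasurableSet[m] A := (measurable_enorm.comp hu) measurableSet_Ici
    have hPA : P A ≠ 0 := by
      intro h0
      refine hc.not_ge (essSup_le_of_ae_le c ?_)
      have : ∀ᵐ ω ∂P, ω ∉ A := measure_eq_zero_iff_ae_notMem.1 h0
      filter_upwards [this] with ω hω
      exact (not_le.1 hω).le
    have hPAt : P A ≠ ∞ := measure_ne_top P A
    set k : ℝ := (P A).toReal⁻¹ with hk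
    have hk0 : 0 ≤ k := by positivity
    have hke : ENNReal.ofReal k = (P A)⁻¹ := by
      rw [hk, ENNReal.ofReal_inv_of_pos (ENNReal.toReal_pos hPA hPAt), ENNReal.ofReal_toReal hPAt]
    have hcoe : ∀ ω, ENNReal.ofReal (A.indicator (fun _ => k) ω) =
        A.indicator (fun _ => (P A)⁻¹) ω := by
      intro ω
      by_cases hω : ω ∈ A <;> simp [hω, hke]
    refine le_trans ?_ (h (A.indicator fun _ => k) k (measurable_const.indicator hAm)
      (fun ω => indicator_nonneg (fun _ _ => hk0) ω)
      (fun ω => indicator_le_self' (fun _ _ => hk0) ω) ?_)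
    · calc c = ∫⁻ ω, A.indicator (fun _ => c * (P A)⁻¹) ω ∂P := by
            rw [lintegral_indicator_const (hm _ hAm), mul_assoc, ENNReal.inv_mul_cancel hPA hPAt,
              mul_one]
        _ ≤ _ := by
            refine lintegral_mono fun ω => ?_
            rw [hcoe]
            by_cases hω : ω ∈ A
            · simp only [indicator_of_mem hω]
              gcongr
              exact hω
            · simp [hω]
    · rw [eLpNorm_one_eq_lintegral_enorm]
      calc ∫⁻ ω, ‖A.indicator (fun _ => k) ω‖ₑ ∂P = ∫⁻ ω, A.indicator (fun _ => (P A)⁻¹) ω ∂P := by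
            refine lintegral_congr fun ω => ?_
            rw [← hcoe, Real.enorm_of_nonneg (indicator_nonneg (fun _ _ => hk0) ω)]
        _ = 1 := by
            rw [lintegral_indicator_const (hm _ hAm), ENNReal.inv_mul_cancel hPA hPAt]
        _ ≤ 1 := le_rfl
  by_cases hp1 : p = 1
  · subst hp1
    rw [eLpNorm_one_eq_lintegral_enorm]
    have := h (fun _ => 1) 1 measurable_const (fun _ => zero_le_one) (fun _ => le_rfl)
      (by
        refine (eLpNorm_le_of_ae_bound (C := 1) (ae_of_all _ fun _ => by simp)).trans ?_
        have : p' = ∞ := (ENNReal.HolderConjugate.eq_top_iff_eq_one p' 1).2 rfl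
        simp [this])
    simpa using this
  have hple : 1 ≤ p := ENNReal.HolderConjugate.one_le p p'
  have hp'top : p' ≠ ∞ := (ENNReal.HolderConjugate.ne_top_iff_ne_one p' p).2 hp1
  set r := p.toReal with hr
  have hpr : p = ENNReal.ofReal r := (ENNReal.ofReal_toReal hptop).symm
  have hr1 : 1 < r := by
    rw [hr, ← ENNReal.toReal_one]
    exact (ENNReal.toReal_lt_toReal ENNReal.one_ne_top hptop).2 (lt_of_le_of_ne hple (Ne.symm hp1))
  have hconj : p' * ENNReal.ofReal (r - 1) = p := by
    have hrc : r.HolderConjugate p'.toReal :=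
      ENNReal.HolderConjugate.toReal_of_ne_top (p := p) (q := p') hptop hp'top
    rw [← ENNReal.ofReal_toReal hp'top, ← ENNReal.ofReal_mul ENNReal.toReal_nonneg, mul_comm,
      hrc.sub_one_mul_conj, hpr]
  let v : ℕ → Ω → ℝ := fun n ω => min |u ω| n
  have hv0 : ∀ n ω, 0 ≤ v n ω := fun n ω => le_min (abs_nonneg _) n.cast_nonneg
  have hvm : ∀ n, Measurable[m] (v n) := fun n =>
    (by fun_prop : Measurable fun x : ℝ => min |x| (n : ℝ)).comp hu
  suffices hv : ∀ n, eLpNorm (v n) p P ≤ C by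
    rw [← eLpNorm_norm]
    refine Lp.eLpNorm_le_of_ae_tendsto (u := atTop) (f := v) (Eventually.of_forall hv)
      (fun n => ((hvm n).mono hm le_rfl).aestronglyMeasurable) (ae_of_all _ fun ω => ?_)
    refine tendsto_atTop_of_eventually_const (i₀ := ⌈|u ω|⌉₊) fun n hn => ?_
    exact min_eq_left ((Nat.le_ceil _).trans (by exact_mod_cast hn))
  intro n
  have hvle : ∀ ω, ‖v n ω‖ ≤ n := fun ω => by
    rw [Real.norm_of_nonneg (hv0 n ω)]
    exact min_le_right _ _
  have hNtop : eLpNorm (v n) p P ≠ ∞ :=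
    ((memLp_top_of_bound ((hvm n).mono hm le_rfl).aestronglyMeasurable n
      (ae_of_all _ hvle)).mono_exponent le_top).2.ne
  by_cases hN0 : eLpNorm (v n) p P = 0
  · simp [hN0]
  set N := (eLpNorm (v n) p P).toReal with hN
  have hNpos : 0 < N := ENNReal.toReal_pos hN0 hNtop
  have hNe : eLpNorm (v n) p P = ENNReal.ofReal N := (ENNReal.ofReal_toReal hNtop).symm
  set k := (N ^ (r - 1))⁻¹ with hk
  have hk0 : 0 ≤ k := by positivity
  have hrpos : 0 < r := zero_lt_one.trans hr1
  have hr10 : 0 < r - 1 := sub_pos.2 hr1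
  refine le_trans ?_ (h (fun ω => k * v n ω ^ (r - 1)) (k * (n : ℝ) ^ (r - 1))
    (((hvm n).pow_const _).const_mul _)
    (fun ω => mul_nonneg hk0 (Real.rpow_nonneg (hv0 n ω) _))
    (fun ω => mul_le_mul_of_nonneg_left
      (Real.rpow_le_rpow (hv0 n ω) (min_le_right _ _) hr10.le) hk0) ?_)
  · have hpow : ∫⁻ ω, ENNReal.ofReal (v n ω ^ r) ∂P = ENNReal.ofReal (N ^ r) := by
      have h1 := eLpNorm_eq_lintegral_rpow_enorm_toReal (f := v n) (μ := P)
        (zero_lt_one.trans_le hple).ne' hptop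
      rw [hNe] at h1
      rw [← ENNReal.ofReal_rpow_of_nonneg hNpos.le hrpos.le, h1, ← ENNReal.rpow_mul,
        one_div, inv_mul_cancel₀ hrpos.ne', ENNReal.rpow_one]
      refine lintegral_congr fun ω => ?_
      rw [Real.enorm_of_nonneg (hv0 n ω), ENNReal.ofReal_rpow_of_nonneg (hv0 n ω) hrpos.le]
    calc eLpNorm (v n) p P = ENNReal.ofReal k * ENNReal.ofReal (N ^ r) := by
          rw [hNe, ← ENNReal.ofReal_mul hk0]
          congr 1
          rw [hk, ← Real.rpow_neg hNpos.le, ← Real.rpow_add hNpos]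
          simp
      _ = ∫⁻ ω, ENNReal.ofReal k * ENNReal.ofReal (v n ω ^ r) ∂P := by
          rw [lintegral_const_mul' _ _ ENNReal.ofReal_ne_top, hpow]
      _ ≤ _ := by
          refine lintegral_mono fun ω => ?_
          rw [← ENNReal.ofReal_mul hk0, ← ofReal_norm, ← ENNReal.ofReal_mul (norm_nonneg _)]
          refine ENNReal.ofReal_le_ofReal ?_
          have e : v n ω ^ r = v n ω * v n ω ^ (r - 1) := by
            rcases (hv0 n ω).eq_or_lt with h0 | h0
            · rw [← h0, Real.zero_rpow hrpos.ne', zero_mul]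
            · rw [← Real.rpow_one_add' h0.le (by linarith)]
              simp
          rw [e, mul_left_comm]
          exact mul_le_mul_of_nonneg_right (min_le_left _ _)
            (mul_nonneg hk0 (Real.rpow_nonneg (hv0 n ω) _))
  · have h1 := eLpNorm_norm_rpow (p := p') (μ := P) (v n) hr10
    rw [hconj, hNe, ENNReal.ofReal_rpow_of_nonneg hNpos.le hr10.le] at h1
    have h2 : (fun ω => k * v n ω ^ (r - 1)) = k • fun ω => ‖v n ω‖ ^ (r - 1) := by
      ext ω
      rw [Pi.smul_apply, Real.norm_of_nonneg (hv0 n ω), smul_eq_mul]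
    rw [h2, eLpNorm_const_smul, h1, Real.enorm_of_nonneg hk0, ← ENNReal.ofReal_mul hk0, hk,
      inv_mul_cancel₀ (by positivity)]
    simp

lemma eLpNorm_le_of_forall_simpleFunc {Ω : Type*} {m mΩ : MeasurableSpace Ω} (P : Measure Ω)
    [IsFiniteMeasure P] (hm : m ≤ mΩ) {p p' : ℝ≥0∞} [ENNReal.HolderConjugate p p']
    {u : Ω → ℝ} (hu : Measurable[m] u) (hui : Integrable u P) {C : ℝ≥0∞}
    (h : ∀ g : @SimpleFunc Ω m ℝ, eLpNorm g p' P ≤ 1 → ‖∫ ω, u ω * g ω ∂P‖ₑ ≤ C) :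
    eLpNorm u p P ≤ C := by
  refine eLpNorm_le_of_forall_nonneg (p' := p') P hm hu fun g K hg hg0 hgK hg1 => ?_
  have hσ : Measurable fun x : ℝ => if 0 ≤ x then (1 : ℝ) else -1 :=
    Measurable.ite measurableSet_Ici measurable_const measurable_const
  set w : Ω → ℝ := fun ω => (if 0 ≤ u ω then (1 : ℝ) else -1) * g ω with hw
  have hwm : Measurable[m] w := (hσ.comp hu).mul hg
  have hwg : ∀ ω, |w ω| = g ω := by
    intro ω
    simp only [hw]
    split_ifs <;> simp [abs_of_nonneg (hg0 ω)]
  have huw : ∀ ω, u ω * w ω = |u ω| * g ω := by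
    intro ω
    simp only [hw]
    split_ifs with h0
    · rw [abs_of_nonneg h0]; ring
    · rw [abs_of_neg (not_le.1 h0)]; ring
  obtain ⟨s, hs, hst⟩ := @exists_simpleFunc_abs_le_tendsto Ω m w hwm
  have hbound : ∀ n, ‖∫ ω, u ω * s n ω ∂P‖ₑ ≤ C := fun n => by
    refine h (s n) (le_trans (eLpNorm_mono fun ω => ?_) hg1)
    rw [Real.norm_eq_abs, Real.norm_of_nonneg (hg0 ω), ← hwg]
    exact hs n ω
  have hlim : Tendsto (fun n => ∫ ω, u ω * s n ω ∂P) atTop (𝓝 (∫ ω, u ω * w ω ∂P)) := by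
    refine tendsto_integral_of_dominated_convergence (fun ω => |u ω| * K) (fun n => ?_)
      (hui.abs.mul_const K) (fun n => ae_of_all _ fun ω => ?_)
      (ae_of_all _ fun ω => (hst ω).const_mul _)
    · exact hui.1.mul
        ((@SimpleFunc.stronglyMeasurable _ _ m _ (s n)).mono hm).aestronglyMeasurable
    · rw [norm_mul, Real.norm_eq_abs, Real.norm_eq_abs]
      gcongr
      exact (hs n ω).trans ((hwg ω).le.trans (hgK ω))
  have hle : ‖∫ ω, u ω * w ω ∂P‖ₑ ≤ C := le_of_tendsto' hlim.enorm hbound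
  refine le_trans (le_of_eq ?_) hle
  simp only [huw]
  have hnn : ∀ ω, 0 ≤ |u ω| * g ω := fun ω => mul_nonneg (abs_nonneg _) (hg0 ω)
  have hgK' : ∀ ω, ‖g ω‖ ≤ K := fun ω => by rw [Real.norm_of_nonneg (hg0 ω)]; exact hgK ω
  have hint : Integrable (fun ω => |u ω| * g ω) P :=
    hui.abs.mul_bdd (hg.mono hm le_rfl).aestronglyMeasurable (ae_of_all _ hgK')
  rw [Real.enorm_of_nonneg (integral_nonneg hnn),
    ofReal_integral_eq_lintegral_ofReal hint (ae_of_all _ hnn)]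
  refine lintegral_congr fun ω => ?_
  rw [ENNReal.ofReal_mul (abs_nonneg _), Real.enorm_eq_ofReal_abs]

lemma varpi_le_of_forall_simpleFunc {Ω : Type*} {G H mΩ : MeasurableSpace Ω} (P : Measure Ω)
    [IsProbabilityMeasure P] (hG : G ≤ mΩ) (hH : H ≤ mΩ)
    {p p' q C : ℝ≥0∞} [ENNReal.HolderConjugate p p'] (hq : 1 ≤ q)
    (h : ∀ (f : @SimpleFunc Ω H ℝ) (g : @SimpleFunc Ω G ℝ), eLpNorm f q P ≤ 1 →
      eLpNorm g p' P ≤ 1 → ‖∫ ω, f ω * g ω ∂P - (∫ ω, f ω ∂P) * ∫ ω, g ω ∂P‖ₑ ≤ C) :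
    varpi P G H q p ≤ C := by
  refine iSup_le fun ⟨u, hu, huq⟩ => ?_
  have hum : AEStronglyMeasurable u P := (hu.mono hH le_rfl).aestronglyMeasurable
  have hui : Integrable u P :=
    MemLp.integrable hq ⟨hum, huq.trans_lt ENNReal.one_lt_top⟩
  refine eLpNorm_le_of_forall_simpleFunc (p' := p') P hG
    (stronglyMeasurable_condExp.measurable.sub_const _)
    (integrable_condExp.sub (integrable_const _)) fun g hg => ?_
  obtain ⟨L, hL⟩ := @SimpleFunc.exists_forall_norm_le _ _ G _ g
  have hgG : StronglyMeasurable[G] g := @SimpleFunc.stronglyMeasurable _ _ G _ g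
  have hgm : AEStronglyMeasurable g P := (hgG.mono hG).aestronglyMeasurable
  rw [integral_condExp_sub_integral_mul P hG hui hgG hL]
  obtain ⟨s, hs, hst⟩ := @exists_simpleFunc_abs_le_tendsto Ω H u hu
  have hsm : ∀ n, AEStronglyMeasurable (s n) P := fun n =>
    ((@SimpleFunc.stronglyMeasurable _ _ H _ (s n)).mono hH).aestronglyMeasurable
  have hlim₁ : Tendsto (fun n => ∫ ω, s n ω * g ω ∂P) atTop (𝓝 (∫ ω, u ω * g ω ∂P)) := by
    refine tendsto_integral_of_dominated_convergence (fun ω => |u ω| * L)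
      (fun n => (hsm n).mul hgm) (hui.abs.mul_const L) (fun n => ae_of_all _ fun ω => ?_)
      (ae_of_all _ fun ω => (hst ω).mul_const _)
    rw [norm_mul]
    exact mul_le_mul (hs n ω) (hL ω) (norm_nonneg _) (abs_nonneg _)
  have hlim₂ : Tendsto (fun n => ∫ ω, s n ω ∂P) atTop (𝓝 (∫ ω, u ω ∂P)) :=
    tendsto_integral_of_dominated_convergence (fun ω => |u ω|) hsm hui.abs
      (fun n => ae_of_all _ fun ω => hs n ω) (ae_of_all _ hst)
  exact le_of_tendsto' (hlim₁.sub (hlim₂.mul_const _)).enorm fun n =>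
    h (s n) g ((eLpNorm_mono (hs n)).trans huq) hg

/-- Entire functions that are bounded on the closed strip `0 ≤ re z ≤ 1`. -/
def IsBoundedOnStrip (F : ℂ → ℂ) : Prop :=
  Differentiable ℂ F ∧ ∃ K, ∀ z ∈ Complex.HadamardThreeLines.verticalClosedStrip 0 1, ‖F z‖ ≤ K

namespace IsBoundedOnStrip

lemma const_mul (c : ℂ) {F : ℂ → ℂ} (hF : IsBoundedOnStrip F) :
    IsBoundedOnStrip fun z => c * F z := by
  obtain ⟨hd, K, hK⟩ := hF
  refine ⟨hd.const_mul c, ‖c‖ * K, fun z hz => ?_⟩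
  rw [norm_mul]
  gcongr
  exact hK z hz

lemma mul {F F' : ℂ → ℂ} (hF : IsBoundedOnStrip F) (hF' : IsBoundedOnStrip F') :
    IsBoundedOnStrip fun z => F z * F' z := by
  obtain ⟨hd, K, hK⟩ := hF
  obtain ⟨hd', K', hK'⟩ := hF'
  refine ⟨hd.mul hd', K * K', fun z hz => ?_⟩
  rw [norm_mul]
  exact mul_le_mul (hK z hz) (hK' z hz) (norm_nonneg _) ((norm_nonneg _).trans (hK z hz))

lemma sub {F F' : ℂ → ℂ} (hF : IsBoundedOnStrip F) (hF' : IsBoundedOnStrip F') :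
    IsBoundedOnStrip fun z => F z - F' z := by
  obtain ⟨hd, K, hK⟩ := hF
  obtain ⟨hd', K', hK'⟩ := hF'
  exact ⟨hd.sub hd', K + K', fun z hz => (norm_sub_le _ _).trans (add_le_add (hK z hz) (hK' z hz))⟩

lemma sum {ι : Type*} (s : Finset ι) {F : ι → ℂ → ℂ} (hF : ∀ i, IsBoundedOnStrip (F i)) :
    IsBoundedOnStrip fun z => ∑ i ∈ s, F i z := by
  choose hd K hK using hF
  exact ⟨Differentiable.fun_sum fun i _ => hd i, ∑ i ∈ s, K i,
    fun z hz => norm_sum_le_of_le _ fun i _ => hK i z hz⟩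

lemma integral_simpleFunc {Ω E : Type*} {mΩ : MeasurableSpace Ω} [NormedAddCommGroup E]
    (P : Measure Ω) [IsFiniteMeasure P] (f : SimpleFunc Ω E) {Φ : ℂ → E → ℂ}
    (hΦ : ∀ y, IsBoundedOnStrip fun z => Φ z y) (h0 : ∀ z, Φ z 0 = 0) :
    IsBoundedOnStrip fun z => ∫ ω, Φ z (f ω) ∂P := by
  have hfi : Integrable f P := SimpleFunc.integrable_of_isFiniteMeasure f
  have heq : (fun z => ∫ ω, Φ z (f ω) ∂P) =
      fun z => ∑ y ∈ f.range, (P.real (f ⁻¹' {y}) : ℂ) * Φ z y := by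
    ext z
    have h1 := SimpleFunc.map_integral f (Φ z) hfi (h0 z)
    rw [SimpleFunc.integral_eq_integral _ (SimpleFunc.integrable_of_isFiniteMeasure _)] at h1
    simpa only [Complex.real_smul, SimpleFunc.map_apply] using h1
  rw [heq]
  exact sum _ fun y => (hΦ y).const_mul _

end IsBoundedOnStrip

/-- `sign x * |x| ^ (a₀ (1 - z) + a₁ z)`, with value `0` at `x = 0`. -/
def signedCpow (a₀ a₁ : ℝ) (z : ℂ) (x : ℝ) : ℂ :=
  ((SignType.sign x : ℝ) : ℂ) * Complex.exp (Real.log x * (a₀ * (1 - z) + a₁ * z))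

lemma signedCpow_zero_right (a₀ a₁ : ℝ) (z : ℂ) : signedCpow a₀ a₁ z 0 = 0 := by
  simp [signedCpow]

lemma norm_signedCpow_le (a₀ a₁ : ℝ) (z : ℂ) (x : ℝ) :
    ‖signedCpow a₀ a₁ z x‖ ≤ |x| ^ (a₀ * (1 - z.re) + a₁ * z.re) := by
  rcases eq_or_ne x 0 with rfl | hx
  · rw [signedCpow_zero_right, norm_zero]
    positivity
  · have hre : (Real.log x * (a₀ * (1 - z) + a₁ * z) : ℂ).re =
        Real.log |x| * (a₀ * (1 - z.re) + a₁ * z.re) := by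
      simp
    have hs : |(SignType.sign x : ℝ)| ≤ 1 := by
      rcases hx.lt_or_gt with h | h
      · simp [sign_neg h]
      · simp [sign_pos h]
    rw [signedCpow, norm_mul, Complex.norm_exp, hre, Complex.norm_real, Real.norm_eq_abs,
      Real.rpow_def_of_pos (abs_pos.2 hx)]
    exact mul_le_of_le_one_left (Real.exp_nonneg _) hs

lemma signedCpow_eq_self {a₀ a₁ θ : ℝ} (h : a₀ * (1 - θ) + a₁ * θ = 1) (x : ℝ) :
    signedCpow a₀ a₁ θ x = x := by
  have h' : (a₀ * (1 - θ) + a₁ * θ : ℂ) = 1 := by exact_mod_cast h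
  rw [signedCpow, h', mul_one, ← Complex.ofReal_exp]
  norm_cast
  rcases lt_trichotomy x 0 with hx | rfl | hx
  · rw [← Real.log_abs, Real.exp_log (abs_pos.2 hx.ne), abs_of_neg hx]
    simp [sign_neg hx]
  · simp
  · rw [Real.exp_log hx]
    simp [sign_pos hx]

lemma isBoundedOnStrip_signedCpow (a₀ a₁ : ℝ) (x : ℝ) :
    IsBoundedOnStrip fun z => signedCpow a₀ a₁ z x := by
  rcases eq_or_ne x 0 with rfl | hx
  · simp only [signedCpow_zero_right]
    exact ⟨differentiable_const _, 0, by simp⟩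
  refine ⟨by unfold signedCpow; fun_prop, Real.exp (|Real.log (|x|)| * (|a₀| + |a₁|)),
    fun z hz => (norm_signedCpow_le a₀ a₁ z x).trans ?_⟩
  have hz' : 0 ≤ z.re ∧ z.re ≤ 1 := hz
  rw [Real.rpow_def_of_pos (abs_pos.2 hx)]
  refine Real.exp_le_exp.2 ((le_abs_self _).trans ?_)
  rw [abs_mul]
  gcongr
  refine (abs_add_le _ _).trans (add_le_add ?_ ?_)
  · rw [abs_mul]
    exact mul_le_of_le_one_right (abs_nonneg _) (abs_le.2 ⟨by linarith, by linarith⟩)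
  · rw [abs_mul]
    exact mul_le_of_le_one_right (abs_nonneg _) (abs_le.2 ⟨by linarith, by linarith⟩)

lemma eLpNorm_le_one_of_norm_le_rpow {Ω E : Type*} [NormedAddCommGroup E] {mΩ : MeasurableSpace Ω}
    (P : Measure Ω) {q r : ℝ≥0∞} (hq : 1 ≤ q) (hqt : q ≠ ∞) (hr : 1 ≤ r) {f : Ω → ℝ}
    (hf : eLpNorm f q P ≤ 1) {h : Ω → E}
    (hh : ∀ ω, ‖h ω‖ ≤ |f ω| ^ (q.toReal * r⁻¹.toReal)) : eLpNorm h r P ≤ 1 := by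
  by_cases hrt : r = ∞
  · subst hrt
    refine (eLpNorm_le_of_ae_bound (C := 1) (ae_of_all _ fun ω => ?_)).trans ?_
    · simpa using hh ω
    · simp
  have hq0 : 0 < q.toReal := ENNReal.toReal_pos (zero_lt_one.trans_le hq).ne' hqt
  have hr0 : 0 < r.toReal := ENNReal.toReal_pos (zero_lt_one.trans_le hr).ne' hrt
  have ha : 0 < q.toReal * r⁻¹.toReal := by
    rw [ENNReal.toReal_inv]
    positivity
  have hexp : r * ENNReal.ofReal (q.toReal * r⁻¹.toReal) = q := by
    conv_lhs => rw [← ENNReal.ofReal_toReal hrt]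
    rw [← ENNReal.ofReal_mul hr0.le, ENNReal.toReal_inv, ENNReal.toReal_ofReal hr0.le,
      mul_comm, mul_assoc, inv_mul_cancel₀ hr0.ne', mul_one, ENNReal.ofReal_toReal hqt]
  calc eLpNorm h r P ≤ eLpNorm (fun ω => ‖f ω‖ ^ (q.toReal * r⁻¹.toReal)) r P :=
        eLpNorm_mono_real hh
    _ = eLpNorm f q P ^ (q.toReal * r⁻¹.toReal) := by rw [eLpNorm_norm_rpow f ha, hexp]
    _ ≤ 1 := ENNReal.rpow_le_one hf ha.le

lemma one_le_of_inv_eq_interp {θ : ℝ} (hθ0 : 0 ≤ θ) (hθ1 : θ ≤ 1) {q q₀ q₁ : ℝ≥0∞}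
    (hq₀ : 1 ≤ q₀) (hq₁ : 1 ≤ q₁)
    (hq : q⁻¹ = ENNReal.ofReal (1 - θ) * q₀⁻¹ + ENNReal.ofReal θ * q₁⁻¹) : 1 ≤ q := by
  rw [← ENNReal.inv_le_one, hq]
  calc _ ≤ ENNReal.ofReal (1 - θ) * 1 + ENNReal.ofReal θ * 1 := by
        gcongr
        · exact ENNReal.inv_le_one.2 hq₀
        · exact ENNReal.inv_le_one.2 hq₁
    _ = 1 := by
        rw [mul_one, mul_one, ← ENNReal.ofReal_add (by linarith) hθ0]
        simp

lemma exists_signedCpow_exponents {θ : ℝ} (hθ0 : 0 < θ) (hθ1 : θ < 1) {q q₀ q₁ : ℝ≥0∞}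
    (hq₀ : 1 ≤ q₀) (hq₁ : 1 ≤ q₁)
    (hq : q⁻¹ = ENNReal.ofReal (1 - θ) * q₀⁻¹ + ENNReal.ofReal θ * q₁⁻¹) :
    ∃ a₀ a₁ : ℝ, a₀ * (1 - θ) + a₁ * θ = 1 ∧
      ∀ {Ω : Type*} {_ : MeasurableSpace Ω} (P : Measure Ω) (f : Ω → ℝ), eLpNorm f q P ≤ 1 →
        (∀ z : ℂ, z.re = 0 → eLpNorm (fun ω => signedCpow a₀ a₁ z (f ω)) q₀ P ≤ 1) ∧
        (∀ z : ℂ, z.re = 1 → eLpNorm (fun ω => signedCpow a₀ a₁ z (f ω)) q₁ P ≤ 1) := by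
  have hq1 : 1 ≤ q := one_le_of_inv_eq_interp hθ0.le hθ1.le hq₀ hq₁ hq
  have hθ1' : 0 < 1 - θ := sub_pos.2 hθ1
  by_cases hqt : q = ∞
  · subst hqt
    have h0 : q₀ = ∞ ∧ q₁ = ∞ := by
      rw [ENNReal.inv_top, eq_comm, add_eq_zero, mul_eq_zero, mul_eq_zero] at hq
      simpa [hθ1, hθ0, not_le.2 hθ1, not_le.2 hθ0] using hq
    obtain ⟨rfl, rfl⟩ := h0
    refine ⟨1, 1, by ring, fun P f hf => ⟨fun z _ => ?_, fun z _ => ?_⟩⟩ <;>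
    · refine le_trans (eLpNorm_mono fun ω => ?_) hf
      simpa using norm_signedCpow_le 1 1 z (f ω)
  · refine ⟨q.toReal * q₀⁻¹.toReal, q.toReal * q₁⁻¹.toReal, ?_, fun P f hf =>
      ⟨fun z hz => eLpNorm_le_one_of_norm_le_rpow P hq1 hqt hq₀ hf fun ω => ?_,
       fun z hz => eLpNorm_le_one_of_norm_le_rpow P hq1 hqt hq₁ hf fun ω => ?_⟩⟩
    · have hi₀ : q₀⁻¹ ≠ ∞ := ((ENNReal.inv_le_one.2 hq₀).trans_lt ENNReal.one_lt_top).ne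
      have hi₁ : q₁⁻¹ ≠ ∞ := ((ENNReal.inv_le_one.2 hq₁).trans_lt ENNReal.one_lt_top).ne
      have hqr := congrArg ENNReal.toReal hq
      rw [ENNReal.toReal_add (ENNReal.mul_ne_top ENNReal.ofReal_ne_top hi₀)
        (ENNReal.mul_ne_top ENNReal.ofReal_ne_top hi₁), ENNReal.toReal_mul, ENNReal.toReal_mul,
        ENNReal.toReal_ofReal hθ1'.le, ENNReal.toReal_ofReal hθ0.le] at hqr
      have hq0 : 0 < q.toReal := ENNReal.toReal_pos (zero_lt_one.trans_le hq1).ne' hqt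
      calc _ = q.toReal * ((1 - θ) * q₀⁻¹.toReal + θ * q₁⁻¹.toReal) := by ring
        _ = 1 := by rw [← hqr, ENNReal.toReal_inv, mul_inv_cancel₀ hq0.ne']
    · simpa [hz] using norm_signedCpow_le (q.toReal * q₀⁻¹.toReal) (q.toReal * q₁⁻¹.toReal) z (f ω)
    · simpa [hz] using norm_signedCpow_le (q.toReal * q₀⁻¹.toReal) (q.toReal * q₁⁻¹.toReal) z (f ω)

lemma inv_eq_interp_of_holderConjugate {θ : ℝ} (hθ0 : 0 ≤ θ) (hθ1 : θ ≤ 1)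
    {p p' p₀ p₀' p₁ p₁' : ℝ≥0∞} [ENNReal.HolderConjugate p p'] [ENNReal.HolderConjugate p₀ p₀']
    [ENNReal.HolderConjugate p₁ p₁']
    (hp : p⁻¹ = ENNReal.ofReal (1 - θ) * p₀⁻¹ + ENNReal.ofReal θ * p₁⁻¹) :
    p'⁻¹ = ENNReal.ofReal (1 - θ) * p₀'⁻¹ + ENNReal.ofReal θ * p₁'⁻¹ := by
  have hpt : p⁻¹ ≠ ∞ := ENNReal.inv_ne_top.2 (ENNReal.HolderConjugate.ne_zero p p')
  refine (ENNReal.add_right_inj hpt).1 ?_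
  rw [ENNReal.HolderConjugate.inv_add_inv_eq_one p p', hp]
  calc (1 : ℝ≥0∞) = ENNReal.ofReal (1 - θ) * 1 + ENNReal.ofReal θ * 1 := by
        rw [mul_one, mul_one, ← ENNReal.ofReal_add (by linarith) hθ0]
        simp
    _ = ENNReal.ofReal (1 - θ) * (p₀⁻¹ + p₀'⁻¹) + ENNReal.ofReal θ * (p₁⁻¹ + p₁'⁻¹) := by
        rw [ENNReal.HolderConjugate.inv_add_inv_eq_one p₀ p₀',
          ENNReal.HolderConjugate.inv_add_inv_eq_one p₁ p₁']
    _ = _ := by ring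

lemma enorm_integral_mul_sub_le_interp {Ω : Type*} {G H mΩ : MeasurableSpace Ω} (P : Measure Ω)
    [IsProbabilityMeasure P] (hG : G ≤ mΩ) (hH : H ≤ mΩ) {θ : ℝ} (hθ0 : 0 < θ) (hθ1 : θ < 1)
    {p p' p₀ p₀' p₁ p₁' q q₀ q₁ : ℝ≥0∞} [ENNReal.HolderConjugate p p']
    [ENNReal.HolderConjugate p₀ p₀'] [ENNReal.HolderConjugate p₁ p₁']
    (hq₀ : 1 ≤ q₀) (hq₁ : 1 ≤ q₁)
    (hp : p⁻¹ = ENNReal.ofReal (1 - θ) * p₀⁻¹ + ENNReal.ofReal θ * p₁⁻¹)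
    (hq : q⁻¹ = ENNReal.ofReal (1 - θ) * q₀⁻¹ + ENNReal.ofReal θ * q₁⁻¹)
    (h₀ : varpi P G H q₀ p₀ ≠ ∞) (h₁ : varpi P G H q₁ p₁ ≠ ∞)
    (f : @SimpleFunc Ω H ℝ) (g : @SimpleFunc Ω G ℝ)
    (hf : eLpNorm f q P ≤ 1) (hg : eLpNorm g p' P ≤ 1) :
    ‖∫ ω, f ω * g ω ∂P - (∫ ω, f ω ∂P) * ∫ ω, g ω ∂P‖ₑ ≤
      2 * varpi P G H q₀ p₀ ^ (1 - θ) * varpi P G H q₁ p₁ ^ θ := by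
  have hp' := inv_eq_interp_of_holderConjugate (p' := p') (p₀' := p₀') (p₁' := p₁')
    hθ0.le hθ1.le hp
  obtain ⟨a₀, a₁, ha, hA⟩ := exists_signedCpow_exponents hθ0 hθ1 hq₀ hq₁ hq
  obtain ⟨b₀, b₁, hb, hB⟩ := exists_signedCpow_exponents hθ0 hθ1
    (ENNReal.HolderConjugate.one_le p₀' p₀) (ENNReal.HolderConjugate.one_le p₁' p₁) hp'
  obtain ⟨hA₀, hA₁⟩ := hA P f hf
  obtain ⟨hB₀, hB₁⟩ := hB P g hg
  set M₀ := (varpi P G H q₀ p₀).toReal with hM₀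
  set M₁ := (varpi P G H q₁ p₁).toReal with hM₁
  let F : ℂ → ℂ := fun z =>
    ∫ ω, signedCpow a₀ a₁ z (f ω) * signedCpow b₀ b₁ z (g ω) ∂P -
      (∫ ω, signedCpow a₀ a₁ z (f ω) ∂P) * ∫ ω, signedCpow b₀ b₁ z (g ω) ∂P
  have hF : IsBoundedOnStrip F := by
    let f' : SimpleFunc Ω ℝ :=
      ⟨f, fun x => hH _ (@SimpleFunc.measurableSet_fiber _ _ H f x),
        @SimpleFunc.finite_range _ _ H f⟩
    let g' : SimpleFunc Ω ℝ :=
      ⟨g, fun x => hG _ (@SimpleFunc.measurableSet_fiber _ _ G g x),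
        @SimpleFunc.finite_range _ _ G g⟩
    have h12 := IsBoundedOnStrip.integral_simpleFunc P (f'.pair g')
      (Φ := fun z y => signedCpow a₀ a₁ z y.1 * signedCpow b₀ b₁ z y.2)
      (fun y => (isBoundedOnStrip_signedCpow a₀ a₁ y.1).mul (isBoundedOnStrip_signedCpow b₀ b₁ y.2))
      (fun z => by simp [signedCpow_zero_right])
    exact h12.sub ((IsBoundedOnStrip.integral_simpleFunc P f'
      (isBoundedOnStrip_signedCpow a₀ a₁) (signedCpow_zero_right a₀ a₁)).mul
      (IsBoundedOnStrip.integral_simpleFunc P g'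
        (isBoundedOnStrip_signedCpow b₀ b₁) (signedCpow_zero_right b₀ b₁)))
  have bound : ∀ {r s s' : ℝ≥0∞} [ENNReal.HolderConjugate s s'], 1 ≤ r → varpi P G H r s ≠ ∞ →
      ∀ z : ℂ, eLpNorm (fun ω => signedCpow a₀ a₁ z (f ω)) r P ≤ 1 →
        eLpNorm (fun ω => signedCpow b₀ b₁ z (g ω)) s' P ≤ 1 →
        ‖F z‖ ≤ 2 * (varpi P G H r s).toReal := by
    intro r s s' _ hr htop z hz hz'
    have h := enorm_integral_mul_sub_le (p := s) (p' := s') P hG hH hr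
      (@SimpleFunc.map _ _ _ H (signedCpow a₀ a₁ z) f)
      (@SimpleFunc.map _ _ _ G (signedCpow b₀ b₁ z) g)
    have h' : ‖F z‖ₑ ≤ 2 * varpi P G H r s := by
      refine h.trans ?_
      calc _ ≤ 2 * varpi P G H r s * 1 * 1 := by
            gcongr
            · exact hz
            · exact hz'
        _ = _ := by ring
    have h2 := ENNReal.toReal_mono (ENNReal.mul_ne_top ENNReal.ofNat_ne_top htop) h'
    simpa using h2
  have key := Complex.HadamardThreeLines.norm_le_interp_of_mem_verticalClosedStrip₀₁' F
    (z := (θ : ℂ)) (a := 2 * M₀) (b := 2 * M₁) ⟨by simpa using hθ0.le, by simpa using hθ1.le⟩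
    hF.1.diffContOnCl
    (by
      obtain ⟨K, hK⟩ := hF.2
      refine ⟨K, ?_⟩
      rintro _ ⟨z, hz, rfl⟩
      exact hK z hz)
    (fun z hz => bound (s' := p₀') hq₀ h₀ z (hA₀ z hz) (hB₀ z hz))
    (fun z hz => bound (s' := p₁') hq₁ h₁ z (hA₁ z hz) (hB₁ z hz))
  have hFθ : F θ = ((∫ ω, f ω * g ω ∂P - (∫ ω, f ω ∂P) * ∫ ω, g ω ∂P : ℝ) : ℂ) := by
    simp only [F, signedCpow_eq_self ha, signedCpow_eq_self hb]
    push_cast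
    rw [← integral_complex_ofReal, ← integral_complex_ofReal, ← integral_complex_ofReal]
    simp
  rw [hFθ, Complex.norm_real, Complex.ofReal_re] at key
  have hM₀0 : 0 ≤ M₀ := ENNReal.toReal_nonneg
  have hM₁0 : 0 ≤ M₁ := ENNReal.toReal_nonneg
  have hconst : (2 * M₀) ^ (1 - θ) * (2 * M₁) ^ θ = 2 * M₀ ^ (1 - θ) * M₁ ^ θ := by
    rw [Real.mul_rpow zero_le_two hM₀0, Real.mul_rpow zero_le_two hM₁0]
    have h2 : (2 : ℝ) ^ (1 - θ) * 2 ^ θ = 2 := by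
      rw [← Real.rpow_add zero_lt_two]
      simp
    linear_combination M₀ ^ (1 - θ) * M₁ ^ θ * h2
  rw [hconst] at key
  rw [← ofReal_norm]
  refine (ENNReal.ofReal_le_ofReal key).trans_eq ?_
  rw [ENNReal.ofReal_mul (by positivity), ENNReal.ofReal_mul (by positivity),
    ← ENNReal.ofReal_rpow_of_nonneg hM₀0 (by linarith), ← ENNReal.ofReal_rpow_of_nonneg hM₁0 hθ0.le,
    hM₀, hM₁, ENNReal.ofReal_toReal h₀, ENNReal.ofReal_toReal h₁]
  simp

/-- `ϖ_{q,p}` vanishes for all exponents as soon as it vanishes for one pair of them. -/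
lemma varpi_eq_zero_of_eq_zero {Ω : Type*} {G H mΩ : MeasurableSpace Ω} (P : Measure Ω)
    [IsProbabilityMeasure P] (hG : G ≤ mΩ) (hH : H ≤ mΩ) {p p' p₀ p₀' q q₀ : ℝ≥0∞}
    [ENNReal.HolderConjugate p p'] [ENNReal.HolderConjugate p₀ p₀'] (hq : 1 ≤ q) (hq₀ : 1 ≤ q₀)
    (h : varpi P G H q₀ p₀ = 0) : varpi P G H q p = 0 := by
  refine le_antisymm (varpi_le_of_forall_simpleFunc (p' := p') P hG hH hq fun f g _ _ => ?_)
    bot_le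
  have hle := enorm_integral_mul_sub_le (p := p₀) (p' := p₀') P hG hH hq₀
    (@SimpleFunc.map _ _ _ H Complex.ofReal f) (@SimpleFunc.map _ _ _ G Complex.ofReal g)
  rw [h, mul_zero, zero_mul, zero_mul] at hle
  have heq : ∫ ω, (f ω : ℂ) * (g ω : ℂ) ∂P - (∫ ω, (f ω : ℂ) ∂P) * ∫ ω, (g ω : ℂ) ∂P =
      ((∫ ω, f ω * g ω ∂P - (∫ ω, f ω ∂P) * ∫ ω, g ω ∂P : ℝ) : ℂ) := by
    push_cast
    rw [← integral_complex_ofReal, ← integral_complex_ofReal, ← integral_complex_ofReal]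
    simp
  refine le_trans (le_of_eq ?_) hle
  change _ = ‖∫ ω, (f ω : ℂ) * (g ω : ℂ) ∂P - (∫ ω, (f ω : ℂ) ∂P) * ∫ ω, (g ω : ℂ) ∂P‖ₑ
  rw [heq, ← ofReal_norm, ← ofReal_norm, Complex.norm_real]

/-- Riesz–Thorin type interpolation inequality for the mixing coefficients. -/
theorem varpi_interpolation
    {Ω : Type*} {mΩ : MeasurableSpace Ω} (P : Measure Ω) [IsProbabilityMeasure P]
    (G H : MeasurableSpace Ω) (hG : G ≤ mΩ) (hH : H ≤ mΩ)
    (θ : ℝ) (hθ0 : 0 ≤ θ) (hθ1 : θ ≤ 1)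
    (p₀ p₁ q₀ q₁ p q : ℝ≥0∞)
    (hp₀ : 1 ≤ p₀) (hp₁ : 1 ≤ p₁) (hq₀ : 1 ≤ q₀) (hq₁ : 1 ≤ q₁)
    (hp : p⁻¹ = ENNReal.ofReal (1 - θ) * p₀⁻¹ + ENNReal.ofReal θ * p₁⁻¹)
    (hq : q⁻¹ = ENNReal.ofReal (1 - θ) * q₀⁻¹ + ENNReal.ofReal θ * q₁⁻¹) :
    varpi P G H q p ≤
      2 * varpi P G H q₀ p₀ ^ (1 - θ) * varpi P G H q₁ p₁ ^ θ := by
  rcases hθ0.eq_or_lt with rfl | hθ0'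
  · obtain rfl : p = p₀ := by simpa using hp
    obtain rfl : q = q₀ := by simpa using hq
    simpa using le_mul_of_one_le_left (bot_le : 0 ≤ varpi P G H q p) one_le_two
  rcases hθ1.eq_or_lt with rfl | hθ1'
  · obtain rfl : p = p₁ := by simpa using hp
    obtain rfl : q = q₁ := by simpa using hq
    simpa using le_mul_of_one_le_left (bot_le : 0 ≤ varpi P G H q p) one_le_two
  have hp1 : 1 ≤ p := one_le_of_inv_eq_interp hθ0 hθ1 hp₀ hp₁ hp
  have hq1 : 1 ≤ q := one_le_of_inv_eq_interp hθ0 hθ1 hq₀ hq₁ hq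
  have := ENNReal.HolderConjugate.conjExponent hp1
  have := ENNReal.HolderConjugate.conjExponent hp₀
  have := ENNReal.HolderConjugate.conjExponent hp₁
  by_cases hz₀ : varpi P G H q₀ p₀ = 0
  · rw [varpi_eq_zero_of_eq_zero (p' := p.conjExponent) (p₀' := p₀.conjExponent) P hG hH
      hq1 hq₀ hz₀]
    exact bot_le
  by_cases hz₁ : varpi P G H q₁ p₁ = 0
  · rw [varpi_eq_zero_of_eq_zero (p' := p.conjExponent) (p₀' := p₁.conjExponent) P hG hH
      hq1 hq₁ hz₁]
    exact bot_le
  by_cases ht₀ : varpi P G H q₀ p₀ = ∞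
  · rw [ht₀, ENNReal.top_rpow_of_pos (sub_pos.2 hθ1'), ENNReal.mul_top two_ne_zero,
      ENNReal.top_mul (ENNReal.rpow_eq_zero_iff_of_pos hθ0' |>.not.2 hz₁)]
    exact le_top
  by_cases ht₁ : varpi P G H q₁ p₁ = ∞
  · rw [ht₁, ENNReal.top_rpow_of_pos hθ0', ENNReal.mul_top (mul_ne_zero two_ne_zero
      (ENNReal.rpow_eq_zero_iff_of_pos (sub_pos.2 hθ1') |>.not.2 hz₀))]
    exact le_top
  exact varpi_le_of_forall_simpleFunc (p' := p.conjExponent) P hG hH hq1 fun f g hf hg =>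
    enorm_integral_mul_sub_le_interp (p' := p.conjExponent) (p₀' := p₀.conjExponent)
      (p₁' := p₁.conjExponent) P hG hH hθ0' hθ1' hq₀ hq₁ hp hq ht₀ ht₁ f g hf hg
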